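/- Let m_11, m_12 be nonnegative integers, let I_Z = (x_0,x_2)^{m_11} ∩ (x_0,x_3)^{m_12} be the ideal of the two collinear fat points Z = m_11 P_11 + m_12 P_12, set M = max{m_11, m_12} and c_t = (m_11 − t)_+ + (m_12 − t)_+ for an integer t. Then for all integers a, b ≥ 0: dim_k (I_Z ∩ R_{(a,b)}) = Σ_{t=0}^{M} (a − t + 1)_+ · (b − c_t + 1)_+ − Σ_{t=1}^{M} (a − t + 1)_+ · (b − c_{t−1} + 1)_+. -/

import Mathlib

open MvPolynomial Module

noncomputable section

/-- The recursively defined function `φ_t(n)` (natural index). -/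
def phiNat : ℕ → ℤ → ℤ
  | 0, _ => 0
  | 1, n => if n = 0 then 1 else 0
  | (t+2), n =>
    if 0 ≤ n ∧ n < (t : ℤ) + 1 then phiNat (t+1) n
    else if (t : ℤ) + 1 ≤ n ∧ n < 2 * ((t : ℤ) + 1) + 1 then phiNat (t+1) n + 1
    else 0

/-- `φ_t : ℤ → ℤ`, identically `0` for `t ≤ 0`. -/
def phi (t n : ℤ) : ℤ := if 0 < t then phiNat t.toNat n else 0

/-- `φ_{t,d}(n) = φ_t(n+d) − φ_d(n+d)`. -/
def phi2 (t d n : ℤ) : ℤ := phi t (n + d) - phi d (n + d)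

/-- `(n)_+ = max{n, 0}`. -/
def pos (n : ℤ) : ℤ := max n 0

variable (k : Type*) [Field k] [CharZero k]

/-- The bigrading weights on `k[x₀,x₁,x₂,x₃]`. -/
def w : Fin 4 → ℕ × ℕ := ![(1,0), (1,0), (0,1), (0,1)]

/-- The bihomogeneous component `R_{(a,b)}` as a `k`-subspace. -/
def comp (a b : ℕ) : Submodule k (MvPolynomial (Fin 4) k) :=
  weightedHomogeneousSubmodule k w (a, b)

/-- The irrelevant ideal `𝔪 = (x₀,x₁,x₂,x₃)`. -/
def mIdeal : Ideal (MvPolynomial (Fin 4) k) :=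
  Ideal.span {X 0, X 1, X 2, X 3}

/-- `β_{0,(a,b)}(I) = dim_k (I ∩ R_{(a,b)}) − dim_k ((𝔪·I) ∩ R_{(a,b)})`. -/
def beta0 (I : Ideal (MvPolynomial (Fin 4) k)) (a b : ℕ) : ℤ :=
  (finrank k ↥(I.restrictScalars k ⊓ comp k a b) : ℤ)
    - (finrank k ↥((mIdeal k * I).restrictScalars k ⊓ comp k a b) : ℤ)

/-- The Hilbert function `H(a,b) = (a+1)(b+1) − dim_k (I ∩ R_{(a,b)})`, `0` off `ℕ²`. -/
def HF (I : Ideal (MvPolynomial (Fin 4) k)) (a b : ℤ) : ℤ :=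
  if 0 ≤ a ∧ 0 ≤ b then
    (a + 1) * (b + 1) - (finrank k ↥(I.restrictScalars k ⊓ comp k a.toNat b.toNat) : ℤ)
  else 0

/-- The first difference `ΔH(a,b)`. -/
def dHF (I : Ideal (MvPolynomial (Fin 4) k)) (a b : ℤ) : ℤ :=
  HF k I a b + HF k I (a-1) (b-1) - HF k I (a-1) b - HF k I a (b-1)

def I11 : Ideal (MvPolynomial (Fin 4) k) := Ideal.span {X 0, X 2}
def I12 : Ideal (MvPolynomial (Fin 4) k) := Ideal.span {X 0, X 3}
def I21 : Ideal (MvPolynomial (Fin 4) k) := Ideal.span {X 1, X 2}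

/-- The ideal of `Z = m₁₁P₁₁ + m₁₂P₁₂ + m₂₁P₂₁`. -/
def IZ (m11 m12 m21 : ℕ) : Ideal (MvPolynomial (Fin 4) k) :=
  I11 k ^ m11 ⊓ I12 k ^ m12 ⊓ I21 k ^ m21

/-- `max{m₁₁, m₁₂ + m₂₁}`. -/
def Dbound (m11 m12 m21 : ℕ) : ℤ := max (m11 : ℤ) ((m12 : ℤ) + m21)

def D1set (m11 m12 m21 : ℕ) : Set (ℕ × ℕ) :=
  {p | (p.2 : ℤ) < pos (-((m12 : ℤ) - m11)) - pos (-((m12 : ℤ) - m11) - m21) ∧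
       (p.1 : ℤ) + 2 * p.2 = (m11 : ℤ) + m21}

def D2set (m11 m12 m21 : ℕ) : Set (ℕ × ℕ) :=
  {p | pos (-((m12 : ℤ) - m11)) - pos (-((m12 : ℤ) - m11) - m21) ≤ (p.2 : ℤ) ∧
       (p.2 : ℤ) < m21 ∧ (p.1 : ℤ) + p.2 = Dbound m11 m12 m21}

def D3set (m11 m12 m21 : ℕ) : Set (ℕ × ℕ) :=
  {p | (m21 : ℤ) ≤ p.2 ∧ (p.2 : ℤ) ≤ m21 + |((m12 : ℤ) - m11) + m21| ∧
       (p.1 : ℤ) + p.2 = Dbound m11 m12 m21}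

def D4set (m11 m12 m21 : ℕ) : Set (ℕ × ℕ) :=
  {p | (m21 : ℤ) + |((m12 : ℤ) - m11) + m21| < (p.2 : ℤ) ∧
       2 * (p.1 : ℤ) + p.2 = (m11 : ℤ) + m12}


/-- A polynomial lies in `(X i, X j) ^ m` exactly when all its monomials do. -/
theorem mem_span_X_pair_pow_iff {σ R : Type*} [CommSemiring R] {i j : σ} (hij : i ≠ j) (m : ℕ)
    (p : MvPolynomial σ R) :
    p ∈ (Ideal.span {X i, X j} : Ideal (MvPolynomial σ R)) ^ m ↔
      ∀ d ∈ p.support, m ≤ d i + d j := by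
  classical
  constructor
  · induction m generalizing p with
    | zero => simp
    | succ m ih =>
      intro hp
      rw [pow_succ] at hp
      refine Submodule.mul_induction_on hp (fun f hf g hg d hd => ?_) fun f g hf hg d hd => ?_
      · obtain ⟨u, hu, v, hv, rfl⟩ := Finset.mem_add.1 (support_mul f g hd)
        have hpair : ({X i, X j} : Set (MvPolynomial σ R)) = X '' {i, j} := by
          simp [Set.image_pair]
        rw [hpair, mem_ideal_span_X_image] at hg
        obtain ⟨l, hl, hvl⟩ := hg v hv
        have := ih f hf u hu
        simp only [Set.mem_insert_iff, Set.mem_singleton_iff] at hl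
        simp only [Finsupp.add_apply]
        rcases hl with rfl | rfl <;> omega
      · rcases Finset.mem_union.1 (support_add hd) with h | h
        exacts [hf d h, hg d h]
  · intro hp
    rw [p.as_sum]
    refine Ideal.sum_mem _ fun d hd => ?_
    have hsplit : d = (Finsupp.single i (d i) + Finsupp.single j (d j)) +
        ((d.erase i).erase j) := by
      ext l
      by_cases hi : l = i
      · subst hi; simp [hij]
      · by_cases hj : l = j
        · subst hj; simp [Ne.symm hij]
        · simp [hi, hj]
    have hfactor : monomial d (coeff d p) =
        (X i ^ d i * X j ^ d j) * monomial ((d.erase i).erase j) (coeff d p) := by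
      rw [X_pow_eq_monomial, X_pow_eq_monomial, monomial_mul, monomial_mul, ← hsplit]
      simp
    rw [hfactor]
    refine Ideal.mul_mem_right _ _ (Ideal.pow_le_pow_right (hp d hd) ?_)
    rw [pow_add]
    exact Ideal.mul_mem_mul (Ideal.pow_mem_pow (Ideal.subset_span (by simp)) _)
      (Ideal.pow_mem_pow (Ideal.subset_span (by simp)) _)

/-- The exponents of the monomials of bidegree `(a, b)` in the ideal of
`m₁₁P₁₁ + m₁₂P₁₂`. -/
def collinearExponents (m11 m12 a b : ℕ) : Set (Fin 4 →₀ ℕ) :=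
  {d | (m11 ≤ d 0 + d 2 ∧ m12 ≤ d 0 + d 3) ∧ d 0 + d 1 = a ∧ d 2 + d 3 = b}

theorem weight_w_eq_iff (d : Fin 4 →₀ ℕ) (a b : ℕ) :
    Finsupp.weight w d = (a, b) ↔ d 0 + d 1 = a ∧ d 2 + d 3 = b := by
  rw [Finsupp.weight_apply, Finsupp.sum_fintype _ _ (by simp)]
  simp [Fin.sum_univ_four, w, Prod.ext_iff, -nsmul_eq_mul]

theorem collinear_inf_comp_eq_restrictSupport (K : Type*) [Field K] (m11 m12 a b : ℕ) :
    (I11 K ^ m11 ⊓ I12 K ^ m12).restrictScalars K ⊓ comp K a b =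
      restrictSupport K (collinearExponents m11 m12 a b) := by
  ext p
  rw [mem_restrictSupport_iff, Submodule.mem_inf, Submodule.restrictScalars_mem,
    Submodule.mem_inf, I11, I12, mem_span_X_pair_pow_iff (by decide),
    mem_span_X_pair_pow_iff (by decide), comp, mem_weightedHomogeneousSubmodule]
  simp only [IsWeightedHomogeneous, weight_w_eq_iff, ← MvPolynomial.mem_support_iff, collinearExponents,
    Set.subset_def, Set.mem_ofPred_eq, Finset.mem_coe]
  exact ⟨fun h d hd => ⟨⟨h.1.1 d hd, h.1.2 d hd⟩, h.2 hd⟩,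
    fun h => ⟨⟨fun d hd => (h d hd).1.1, fun d hd => (h d hd).1.2⟩, fun d hd => (h d hd).2⟩⟩

/-- An exponent in `collinearExponents` is determined by its values at `0` and `2`. -/
def collinearExponentsEquiv (m11 m12 a b : ℕ) :
    collinearExponents m11 m12 a b ≃
      (Finset.range (a + 1)).sigma fun i => Finset.Ico (m11 - i) (b + 1 - (m12 - i)) where
  toFun d := ⟨⟨d.1 0, d.1 2⟩, by
    obtain ⟨d, ⟨h1, h2⟩, h3, h4⟩ := d
    simp only [Finset.mem_sigma, Finset.mem_range, Finset.mem_Ico]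
    omega⟩
  invFun x := ⟨Finsupp.equivFunOnFinite.symm ![x.1.1, a - x.1.1, x.1.2, b - x.1.2], by
    obtain ⟨⟨i, j⟩, h⟩ := x
    simp only [Finset.mem_sigma, Finset.mem_range, Finset.mem_Ico] at h
    simp [collinearExponents]
    omega⟩
  left_inv := by
    rintro ⟨d, ⟨h1, h2⟩, h3, h4⟩
    ext l
    fin_cases l <;> simp <;> omega
  right_inv x := by simp

theorem card_collinearExponents (m11 m12 a b : ℕ) :
    (Nat.card (collinearExponents m11 m12 a b) : ℤ) =
      ∑ t ∈ Finset.range (a + 1),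
        pos ((b : ℤ) - (pos ((m11 : ℤ) - t) + pos ((m12 : ℤ) - t)) + 1) := by
  rw [Nat.card_congr (collinearExponentsEquiv m11 m12 a b), Nat.card_eq_fintype_card,
    Fintype.card_coe, Finset.card_sigma, Nat.cast_sum]
  refine Finset.sum_congr rfl fun t _ => ?_
  rw [Nat.card_Ico]
  simp only [pos]
  omega

/-- Summation by parts against the weights `(a - t + 1)_+`, for a function that is constant
from `M` on. -/
theorem sum_pos_mul_sub_sum_pos_mul (f : ℤ → ℤ) (a M : ℕ) (hf : ∀ t : ℕ, M ≤ t → f t = f M) :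
    (∑ t ∈ Finset.range (M + 1), pos ((a : ℤ) - t + 1) * f t) -
        ∑ t ∈ Finset.Icc 1 M, pos ((a : ℤ) - t + 1) * f ((t : ℤ) - 1) =
      ∑ t ∈ Finset.range (a + 1), f t := by
  have hshift : ∑ t ∈ Finset.Icc 1 M, pos ((a : ℤ) - t + 1) * f ((t : ℤ) - 1) =
      ∑ t ∈ Finset.range M, pos ((a : ℤ) - t) * f t := by
    rw [← Finset.Ico_add_one_right_eq_Icc, Finset.sum_Ico_eq_sum_range]
    refine Finset.sum_congr rfl fun t _ => ?_
    push_cast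
    congr 2 <;> ring
  have hpartial (N : ℕ) : (∑ t ∈ Finset.range N, pos ((a : ℤ) - t + 1) * f t) -
      ∑ t ∈ Finset.range N, pos ((a : ℤ) - t) * f t = ∑ t ∈ Finset.range (min N (a + 1)), f t := by
    induction N with
    | zero => simp
    | succ N ih =>
      rw [Finset.sum_range_succ, Finset.sum_range_succ]
      rcases le_or_gt N a with h | h
      · rw [min_eq_left (by omega)] at ih ⊢
        rw [Finset.sum_range_succ, ← ih]
        have h1 : pos ((a : ℤ) - N + 1) = a - N + 1 := by simp only [pos]; omega
        have h2 : pos ((a : ℤ) - N) = a - N := by simp only [pos]; omega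
        rw [h1, h2]
        ring
      · rw [min_eq_right (by omega)] at ih ⊢
        have h1 : pos ((a : ℤ) - N + 1) = 0 := by simp only [pos]; omega
        have h2 : pos ((a : ℤ) - N) = 0 := by simp only [pos]; omega
        rw [← ih, h1, h2]
        ring
  rw [hshift, Finset.sum_range_succ, add_sub_right_comm, hpartial]
  rcases le_or_gt M a with h | h
  · rw [min_eq_left (by omega), ← Finset.sum_range_add_sum_Ico _ (show M ≤ a + 1 by omega),
      Finset.sum_congr rfl fun t ht => hf t (Finset.mem_Ico.1 ht).1]
    have : pos ((a : ℤ) - M + 1) = ((a + 1 - M : ℕ) : ℤ) := by simp only [pos]; omega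
    simp [this]
  · have : pos ((a : ℤ) - M + 1) = 0 := by simp only [pos]; omega
    rw [min_eq_right (by omega), this]
    ring

/-- Lemma 2.2 (Hilbert-function form): dimension of the bidegree-`(a,b)` component of the
ideal of two collinear fat points, computed from its minimal free resolution. Here
`c_t = (m₁₁−t)_+ + (m₁₂−t)_+` and `M = max{m₁₁, m₁₂}`. -/
theorem dim_two_collinear_fat_points (m11 m12 : ℕ) (a b : ℕ) :
    (finrank k ↥((I11 k ^ m11 ⊓ I12 k ^ m12).restrictScalars k ⊓ comp k a b) : ℤ) =
      (∑ t ∈ Finset.range (max m11 m12 + 1),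
        pos ((a : ℤ) - t + 1) *
          pos ((b : ℤ) - (pos ((m11 : ℤ) - t) + pos ((m12 : ℤ) - t)) + 1)) -
      ∑ t ∈ Finset.Icc 1 (max m11 m12),
        pos ((a : ℤ) - t + 1) *
          pos ((b : ℤ) - (pos ((m11 : ℤ) - ((t : ℤ) - 1)) + pos ((m12 : ℤ) - ((t : ℤ) - 1))) + 1) := by
  rw [collinear_inf_comp_eq_restrictSupport,
    finrank_eq_nat_card_basis (basisRestrictSupport k (collinearExponents m11 m12 a b)),
    card_collinearExponents]
  refine (sum_pos_mul_sub_sum_pos_mul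
    (fun t => pos ((b : ℤ) - (pos ((m11 : ℤ) - t) + pos ((m12 : ℤ) - t)) + 1)) a
    (max m11 m12) fun t ht => ?_).symm
  simp only [pos]
  omega

end
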